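/- arXiv:2203.06261 — 11 statements merged into one kernel-verified Lean document; each statement's English description precedes it below -/
import Mathlib

section
/- For every natural number n, every real constant c with 0 ≤ c, and every vector of arrival times τ : Fin n → ℝ, the delay matrix r : Matrix (Fin n) (Fin n) ℝ defined by r i j = Real.exp (-c * (τ i - τ j)^2) is positive semidefinite (Matrix.PosSemidef r). -/
/-- The delay matrix `r i j = exp (-c * (τ i - τ j)^2)` of an interferometry
experiment with arrival times `τ` and nonnegative constant `c` is positive
semidefinite. -/
theorem delay_matrix_posSemidef (n : ℕ) (c : ℝ) (hc : 0 ≤ c) (τ : Fin n → ℝ) :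
    Matrix.PosSemidef (Matrix.of fun i j : Fin n => Real.exp (-c * (τ i - τ j) ^ 2)) := by
  apply Matrix.PosSemidef.of_dotProduct_mulVec_nonneg
  · ext i j
    simp only [Matrix.conjTranspose_apply, Matrix.of_apply, star_trivial]
    congr 1
    ring
  · intro x
    have key : ∀ i j, HasSum (fun k : ℕ => (2 * c) ^ k / (k.factorial : ℝ) *
        ((x i * Real.exp (-c * τ i ^ 2) * τ i ^ k) * (x j * Real.exp (-c * τ j ^ 2) * τ j ^ k)))
        (x i * (Real.exp (-c * (τ i - τ j) ^ 2) * x j)) := by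
      intro i j
      have h := NormedSpace.expSeries_div_hasSum_exp (𝔸 := ℝ) (2 * c * τ i * τ j)
      rw [← Real.exp_eq_exp_ℝ] at h
      have h2 := h.mul_left (x i * x j * (Real.exp (-c * τ i ^ 2) * Real.exp (-c * τ j ^ 2)))
      convert! h2 using 1
      · funext k
        simp only [mul_pow]
        ring
      · have : -c * (τ i - τ j) ^ 2 = -c * τ i ^ 2 + -c * τ j ^ 2 + 2 * c * τ i * τ j := by ring
        rw [this, Real.exp_add, Real.exp_add]
        ring
    have hs := hasSum_sum (s := Finset.univ) fun i _ =>
      hasSum_sum (s := Finset.univ) fun j _ => key i j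
    have he : star x ⬝ᵥ (Matrix.of fun i j : Fin n =>
        Real.exp (-c * (τ i - τ j) ^ 2)).mulVec x =
        ∑ i, ∑ j, x i * (Real.exp (-c * (τ i - τ j) ^ 2) * x j) := by
      simp only [dotProduct, Matrix.mulVec, Matrix.of_apply, Pi.star_apply, star_trivial,
        Finset.mul_sum]
    rw [he]
    refine hs.nonneg fun k => ?_
    simp only [← Finset.mul_sum, ← Finset.sum_mul]
    exact mul_nonneg (by positivity) (mul_self_nonneg _)
end

section
/- For every natural number n, every real constant c with 0 < c, and every τ : Fin n → ℝ, the delay matrix r : Matrix (Fin n) (Fin n) ℝ with entries r i j = Real.exp (-c * (τ i - τ j)^2) is positive definite (Matrix.PosDef r) if and only if τ is injective (i.e., all arrival times are pairwise distinct). -/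
/-- For `0 < c`, the delay matrix `r i j = exp (-c * (τ i - τ j)^2)` is positive
definite if and only if the arrival times are pairwise distinct. -/
theorem delay_matrix_posDef_iff_injective (n : ℕ) (c : ℝ) (hc : 0 < c) (τ : Fin n → ℝ) :
    Matrix.PosDef (Matrix.of fun i j : Fin n => Real.exp (-c * (τ i - τ j) ^ 2)) ↔
      Function.Injective τ := by
  constructor
  · intro h i j hij
    by_contra hne
    have hu := (Matrix.isUnit_iff_isUnit_det _).1 h.isUnit
    rw [Matrix.det_zero_of_row_eq hne (by ext k; simp [hij])] at hu
    simp at hu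
  · intro hτ
    refine Matrix.PosDef.of_dotProduct_mulVec_pos ?_ ?_
    · ext i j
      simp only [Matrix.conjTranspose_apply, Matrix.of_apply, star_trivial]
      congr 1
      ring
    · intro x hx
      set y : Fin n → ℝ := fun i => x i * Real.exp (-c * τ i ^ 2) with hy
      have hQ : star x ⬝ᵥ ((Matrix.of fun i j : Fin n => Real.exp (-c * (τ i - τ j) ^ 2)).mulVec x)
          = ∑ i, ∑ j, y i * y j * Real.exp (2 * c * τ i * τ j) := by
        simp only [dotProduct, Matrix.mulVec, Matrix.of_apply, star_trivial, Finset.mul_sum]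
        refine Finset.sum_congr rfl fun i _ => Finset.sum_congr rfl fun j _ => ?_
        have : Real.exp (-c * (τ i - τ j) ^ 2) = Real.exp (-c * τ i ^ 2) *
            Real.exp (-c * τ j ^ 2) * Real.exp (2 * c * τ i * τ j) := by
          rw [← Real.exp_add, ← Real.exp_add]
          congr 1
          ring
        rw [this, hy]
        ring
      have hS : HasSum (fun k : ℕ => (2 * c) ^ k / (k.factorial : ℝ) * (∑ i, y i * τ i ^ k) ^ 2)
          (∑ i, ∑ j, y i * y j * Real.exp (2 * c * τ i * τ j)) := by
        have h1 : HasSum (fun k : ℕ => ∑ i, ∑ j, y i * y j *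
            ((2 * c * τ i * τ j) ^ k / (k.factorial : ℝ)))
            (∑ i, ∑ j, y i * y j * Real.exp (2 * c * τ i * τ j)) := by
          refine hasSum_sum fun i _ => hasSum_sum fun j _ => HasSum.mul_left _ ?_
          rw [Real.exp_eq_exp_ℝ]
          exact NormedSpace.expSeries_div_hasSum_exp _
        convert h1 using 2 with k
        rw [sq, Finset.sum_mul_sum, Finset.mul_sum]
        refine Finset.sum_congr rfl fun i _ => ?_
        rw [Finset.mul_sum]
        refine Finset.sum_congr rfl fun j _ => ?_
        rw [mul_pow, mul_pow]
        ring
      rw [hQ]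
      have hk : ∃ k : ℕ, ∑ i, y i * τ i ^ k ≠ 0 := by
        by_contra! hcon
        apply hx
        have hy0 : y = 0 := Matrix.eq_zero_of_forall_pow_sum_mul_pow_eq_zero hτ
          fun k => hcon k
        ext i
        have := congrFun hy0 i
        simpa [hy, Real.exp_ne_zero] using this
      obtain ⟨k, hk⟩ := hk
      have hpos : 0 < (2 * c) ^ k / (k.factorial : ℝ) * (∑ i, y i * τ i ^ k) ^ 2 := by
        positivity
      refine hpos.trans_le (le_hasSum hS k fun j _ => ?_)
      positivity
end

section
/- Let R be a commutative ring, n a natural number, and r : Matrix (Fin n) (Fin n) R a symmetric matrix (rᵀ = r). Define the rate matrix R_b : Matrix (Equiv.Perm (Fin n)) (Equiv.Perm (Fin n)) R by R_b γ σ = ∏ i, r (γ⁻¹ i) (σ⁻¹ i). Then (1) R_b γ σ = ∏ i, r ((γ⁻¹ * σ) i) i, so each entry is the monomial of r indexed by γ⁻¹σ; (2) R_b is symmetric: R_b γ σ = R_b σ γ; and (3) R_b is left-invariant: R_b (π * γ) (π * σ) = R_b γ σ for every permutation π. In particular every permutation monomial occurs exactly once in each row and each column of R_b. -/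
/-- Properties of the bosonic rate matrix `R_b γ σ = ∏ i, r (γ⁻¹ i) (σ⁻¹ i)` built
from a symmetric matrix `r`:
(1) each entry is the permutation monomial of `r` indexed by `γ⁻¹σ`;
(2) `R_b` is symmetric;
(3) `R_b` is invariant under simultaneous left translation of its indices. -/
theorem rate_matrix_entries_symm_invariant {R : Type*} [CommRing R] (n : ℕ)
    (r : Matrix (Fin n) (Fin n) R) (hr : r.transpose = r)
    (Rb : Matrix (Equiv.Perm (Fin n)) (Equiv.Perm (Fin n)) R)
    (hRb : ∀ γ σ : Equiv.Perm (Fin n), Rb γ σ = ∏ i, r (γ⁻¹ i) (σ⁻¹ i)) :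
    (∀ γ σ : Equiv.Perm (Fin n), Rb γ σ = ∏ i, r ((γ⁻¹ * σ) i) i) ∧
    (∀ γ σ : Equiv.Perm (Fin n), Rb γ σ = Rb σ γ) ∧
    (∀ π γ σ : Equiv.Perm (Fin n), Rb (π * γ) (π * σ) = Rb γ σ) := by
  have h1 : ∀ γ σ : Equiv.Perm (Fin n), Rb γ σ = ∏ i, r ((γ⁻¹ * σ) i) i := by
    intro γ σ
    rw [hRb, ← Equiv.prod_comp σ]
    simp
  refine ⟨h1, ?_, ?_⟩
  · intro γ σ
    rw [hRb, hRb]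
    refine Finset.prod_congr rfl fun i _ => ?_
    exact (congrFun (congrFun hr (σ⁻¹ i)) (γ⁻¹ i))
  · intro π γ σ
    rw [h1, h1]
    have h : (π * γ)⁻¹ * (π * σ) = γ⁻¹ * σ := by group
    rw [h]
end

section
/- Let n be a natural number and r : Matrix (Fin n) (Fin n) ℝ a positive semidefinite matrix. Then the bosonic rate matrix R_b : Matrix (Equiv.Perm (Fin n)) (Equiv.Perm (Fin n)) ℝ defined by R_b γ σ = ∏ i, r (γ⁻¹ i) (σ⁻¹ i) is positive semidefinite. -/
theorem rate_matrix_aux (n : ℕ) (r : Matrix (Fin n) (Fin n) ℝ)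
    (hr : r.PosSemidef) (s : Finset (Fin n)) :
    Matrix.PosSemidef
      (Matrix.of fun γ σ : Equiv.Perm (Fin n) => ∏ i ∈ s, r (γ⁻¹ i) (σ⁻¹ i)) := by
  classical
  induction s using Finset.induction_on with
  | empty =>
    convert Matrix.posSemidef_vecMulVec_self_star (fun _ : Equiv.Perm (Fin n) => (1 : ℝ)) using 1
    ext γ σ
    simp [Matrix.vecMulVec_apply]
  | insert a s ha ih =>
    have h := (hr.submatrix (fun γ : Equiv.Perm (Fin n) => γ⁻¹ a)).hadamard ih
    have e : (Matrix.of fun γ σ : Equiv.Perm (Fin n) => ∏ i ∈ insert a s, r (γ⁻¹ i) (σ⁻¹ i)) =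
        Matrix.hadamard (r.submatrix (fun γ : Equiv.Perm (Fin n) => γ⁻¹ a) (fun γ => γ⁻¹ a))
          (Matrix.of fun γ σ : Equiv.Perm (Fin n) => ∏ i ∈ s, r (γ⁻¹ i) (σ⁻¹ i)) := by
      ext γ σ
      simp [Finset.prod_insert ha, Matrix.hadamard_apply]
    rw [e]
    exact h

/-- The bosonic rate matrix (Schur power matrix) of a positive semidefinite matrix
`r` is positive semidefinite. -/
theorem rate_matrix_posSemidef (n : ℕ) (r : Matrix (Fin n) (Fin n) ℝ)
    (hr : r.PosSemidef) :
    Matrix.PosSemidef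
      (Matrix.of fun γ σ : Equiv.Perm (Fin n) => ∏ i, r (γ⁻¹ i) (σ⁻¹ i)) := by
  exact rate_matrix_aux n r hr Finset.univ
end

section
/- Let n be a natural number and r : Matrix (Fin n) (Fin n) ℝ a positive semidefinite matrix. Then the fermionic rate matrix R_f : Matrix (Equiv.Perm (Fin n)) (Equiv.Perm (Fin n)) ℝ defined by R_f γ σ = (Equiv.Perm.sign γ : ℝ) * (Equiv.Perm.sign σ : ℝ) * ∏ i, r (γ⁻¹ i) (σ⁻¹ i) is positive semidefinite. -/
theorem prod_posSemidef_aux {n : ℕ} (r : Matrix (Fin n) (Fin n) ℝ) (hr : r.PosSemidef)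
    (v : Equiv.Perm (Fin n) → ℝ) (s : Finset (Fin n)) :
    Matrix.PosSemidef
      (Matrix.of fun γ σ : Equiv.Perm (Fin n) =>
        (v γ * v σ) * ∏ i ∈ s, r (γ⁻¹ i) (σ⁻¹ i)) := by
  induction s using Finset.induction_on with
  | empty =>
    convert Matrix.posSemidef_vecMulVec_self_star v using 1
    ext γ σ
    simp [Matrix.vecMulVec_apply]
  | insert a s ha ih =>
    have e : (Matrix.of fun γ σ : Equiv.Perm (Fin n) =>
        (v γ * v σ) * ∏ i ∈ insert a s, r (γ⁻¹ i) (σ⁻¹ i)) =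
        Matrix.hadamard (Matrix.of fun γ σ : Equiv.Perm (Fin n) =>
          (v γ * v σ) * ∏ i ∈ s, r (γ⁻¹ i) (σ⁻¹ i))
          (r.submatrix (fun γ : Equiv.Perm (Fin n) => γ⁻¹ a) (fun γ => γ⁻¹ a)) := by
      ext γ σ
      simp only [Matrix.of_apply, Matrix.hadamard_apply, Matrix.submatrix_apply,
        Finset.prod_insert ha]
      ring
    rw [e]
    exact ih.hadamard (hr.submatrix (fun γ : Equiv.Perm (Fin n) => γ⁻¹ a))

/-- The fermionic rate matrix of a positive semidefinite matrix `r` is positive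
semidefinite. -/
theorem fermionic_rate_matrix_posSemidef (n : ℕ) (r : Matrix (Fin n) (Fin n) ℝ)
    (hr : r.PosSemidef) :
    Matrix.PosSemidef
      (Matrix.of fun γ σ : Equiv.Perm (Fin n) =>
        ((Equiv.Perm.sign γ : ℝ) * (Equiv.Perm.sign σ : ℝ)) * ∏ i, r (γ⁻¹ i) (σ⁻¹ i)) := by
  exact prod_posSemidef_aux r hr (fun γ => (Equiv.Perm.sign γ : ℝ)) Finset.univ
end

section
/- Let n be a natural number, A : Matrix (Fin n) (Fin n) ℂ, c : ℝ with 0 ≤ c, and τ : Fin n → ℝ. Define for each permutation γ : Equiv.Perm (Fin n) the monomial v γ = ∏ i, A (γ i) i, and the bosonic coincidence rate S = ∑ γ, ∑ σ, (starRingEnd ℂ) (v γ) * ((∏ i, Real.exp (-c * (τ (γ⁻¹ i) - τ (σ⁻¹ i))^2) : ℝ) : ℂ) * (v σ). Then S is a nonnegative real number: S.im = 0 and 0 ≤ S.re. -/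
open scoped ComplexOrder in
open MeasureTheory ProbabilityTheory in
lemma gauss_psd {ι : Type*} [Fintype ι] (c : ℝ) (hc : 0 ≤ c) (x : ι → ℝ) :
    (Matrix.of fun a b : ι => ((Real.exp (-c * (x a - x b) ^ 2) : ℝ) : ℂ)).PosSemidef := by
  classical
  let μ := gaussianReal 0 (2 * c).toNNReal
  have hk : ∀ a b, ((Real.exp (-c * (x a - x b) ^ 2) : ℝ) : ℂ)
      = ∫ t, Complex.exp ((x b - x a : ℝ) * t * Complex.I) ∂μ := by
    intro a b
    rw [← charFun_apply_real, charFun_gaussianReal]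
    have : (((2 * c).toNNReal : ℝ) : ℂ) = 2 * c := by
      rw [Real.coe_toNNReal _ (by positivity)]; push_cast; rfl
    rw [this]
    push_cast
    congr 1
    ring
  have hint : ∀ y : ℝ, Integrable (fun t : ℝ => Complex.exp (y * t * Complex.I)) μ := by
    intro y
    refine Integrable.of_bound (C := 1) (by fun_prop) (Filter.Eventually.of_forall fun t => ?_)
    have := Complex.norm_exp_ofReal_mul_I (y * t)
    push_cast at this
    exact this.le
  refine Matrix.PosSemidef.of_dotProduct_mulVec_nonneg ?_ ?_
  · ext a b
    simp only [Matrix.conjTranspose_apply, Matrix.of_apply]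
    rw [← Complex.conj_ofReal]
    simp only [RCLike.star_def, Complex.conj_ofReal]
    congr 3
    ring
  · intro z
    have : star z ⬝ᵥ ((Matrix.of fun a b : ι => ((Real.exp (-c * (x a - x b) ^ 2) : ℝ) : ℂ)).mulVec z)
        = ((∫ t, Complex.normSq (∑ b, z b * Complex.exp (x b * t * Complex.I)) ∂μ : ℝ) : ℂ) := by
      rw [← integral_complex_ofReal]
      simp only [dotProduct, Matrix.mulVec, Matrix.of_apply, hk, Pi.star_apply, Finset.mul_sum]
      have e : ∀ t : ℝ, ((Complex.normSq (∑ b, z b * Complex.exp (x b * t * Complex.I)) : ℝ) : ℂ)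
          = ∑ a, ∑ b, (star (z a) * z b) * Complex.exp ((x b - x a : ℝ) * t * Complex.I) := by
        intro t
        rw [Complex.normSq_eq_conj_mul_self, map_sum, Finset.sum_mul_sum]
        refine Finset.sum_congr rfl fun a _ => Finset.sum_congr rfl fun b _ => ?_
        have : Complex.exp ((x b - x a : ℝ) * t * Complex.I)
            = Complex.exp (-(x a * t * Complex.I)) * Complex.exp (x b * t * Complex.I) := by
          rw [← Complex.exp_add]; congr 1; push_cast; ring
        rw [this, map_mul, ← Complex.exp_conj]
        simp only [map_mul, Complex.conj_ofReal, Complex.conj_I, RCLike.star_def, mul_neg]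
        ring
      simp only [e]
      rw [integral_finsetSum _ fun a _ => integrable_finsetSum _ fun b _ => (hint _).const_mul _]
      refine Finset.sum_congr rfl fun a _ => ?_
      rw [integral_finsetSum _ fun b _ => (hint _).const_mul _]
      refine Finset.sum_congr rfl fun b _ => ?_
      rw [integral_const_mul]
      ring
    rw [this]
    exact Complex.zero_le_real.2 (integral_nonneg fun t => Complex.normSq_nonneg _)

open scoped ComplexOrder in
lemma prod_psd {ι κ : Type*} [Fintype ι] (s : Finset κ) (c : ℝ) (hc : 0 ≤ c) (x : κ → ι → ℝ) :
    (Matrix.of fun a b : ι =>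
      ((∏ i ∈ s, Real.exp (-c * (x i a - x i b) ^ 2) : ℝ) : ℂ)).PosSemidef := by
  classical
  induction s using Finset.induction_on with
  | empty => simpa using gauss_psd (ι := ι) 0 le_rfl (fun _ => 0)
  | insert i s hi ih =>
    have := (gauss_psd c hc (x i)).hadamard ih
    have e : (Matrix.of fun a b : ι =>
        ((∏ i ∈ insert i s, Real.exp (-c * (x i a - x i b) ^ 2) : ℝ) : ℂ))
        = (Matrix.of fun a b => ((Real.exp (-c * (x i a - x i b) ^ 2) : ℝ) : ℂ)).hadamard
          (Matrix.of fun a b => ((∏ i ∈ s, Real.exp (-c * (x i a - x i b) ^ 2) : ℝ) : ℂ)) := by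
      ext a b
      simp [Finset.prod_insert hi, Matrix.hadamard]
    rw [e]
    exact this


open scoped ComplexOrder in
lemma rate_aux (n : ℕ) (c : ℝ) (hc : 0 ≤ c) (τ : Fin n → ℝ)
    (v : Equiv.Perm (Fin n) → ℂ) (S : ℂ)
    (hS : S = ∑ γ : Equiv.Perm (Fin n), ∑ σ : Equiv.Perm (Fin n),
      (starRingEnd ℂ) (v γ) *
        ((∏ i, Real.exp (-c * (τ (γ⁻¹ i) - τ (σ⁻¹ i)) ^ 2) : ℝ) : ℂ) * v σ) :
    S.im = 0 ∧ 0 ≤ S.re := by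
  have h := (prod_psd Finset.univ c hc
    (fun (i : Fin n) (γ : Equiv.Perm (Fin n)) => τ (γ⁻¹ i))).dotProduct_mulVec_nonneg v
  have e : S = star v ⬝ᵥ ((Matrix.of fun γ σ : Equiv.Perm (Fin n) =>
      ((∏ i, Real.exp (-c * (τ (γ⁻¹ i) - τ (σ⁻¹ i)) ^ 2) : ℝ) : ℂ)).mulVec v) := by
    rw [hS]
    simp only [dotProduct, Matrix.mulVec, Matrix.of_apply, Pi.star_apply, Finset.mul_sum,
      RCLike.star_def, mul_assoc]
  rw [← e, Complex.le_def] at h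
  exact ⟨h.2.symm, h.1⟩

/-- The bosonic coincidence rate
`S = ∑ γ σ, conj(A_γ) · (∏ i, exp (-c (τ_{γ⁻¹ i} - τ_{σ⁻¹ i})²)) · A_σ`
is a nonnegative real number. -/
theorem bosonic_rate_nonneg_real (n : ℕ) (A : Matrix (Fin n) (Fin n) ℂ)
    (c : ℝ) (hc : 0 ≤ c) (τ : Fin n → ℝ)
    (v : Equiv.Perm (Fin n) → ℂ) (hv : ∀ γ : Equiv.Perm (Fin n), v γ = ∏ i, A (γ i) i)
    (S : ℂ)
    (hS : S = ∑ γ : Equiv.Perm (Fin n), ∑ σ : Equiv.Perm (Fin n),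
      (starRingEnd ℂ) (v γ) *
        ((∏ i, Real.exp (-c * (τ (γ⁻¹ i) - τ (σ⁻¹ i)) ^ 2) : ℝ) : ℂ) * v σ) :
    S.im = 0 ∧ 0 ≤ S.re := by
  exact rate_aux n c hc τ v S hS
end

section
/- Let n be a natural number, A : Matrix (Fin n) (Fin n) ℂ, c : ℝ with 0 ≤ c, and τ : Fin n → ℝ. Define for each permutation γ : Equiv.Perm (Fin n) the monomial v γ = ∏ i, A (γ i) i, and the fermionic coincidence rate S = ∑ γ, ∑ σ, ((Equiv.Perm.sign γ : ℤ) * (Equiv.Perm.sign σ : ℤ) : ℂ) * (starRingEnd ℂ) (v γ) * ((∏ i, Real.exp (-c * (τ (γ⁻¹ i) - τ (σ⁻¹ i))^2) : ℝ) : ℂ) * (v σ). Then S is a nonnegative real number: S.im = 0 and 0 ≤ S.re. -/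
open scoped ComplexOrder

open MeasureTheory ProbabilityTheory in
lemma gauss_kernel_psd {ι : Type*} [Fintype ι] (c : ℝ) (hc : 0 ≤ c) (a : ι → ℝ) :
    Matrix.PosSemidef (Matrix.of fun i j : ι => ((Real.exp (-c * (a i - a j) ^ 2) : ℝ) : ℂ)) := by
  refine Matrix.PosSemidef.of_dotProduct_mulVec_nonneg ?_ ?_
  · ext i j
    simp only [Matrix.conjTranspose_apply, Matrix.of_apply, RCLike.star_def, Complex.conj_ofReal]
    rw [← neg_sub (a i) (a j), neg_sq]
  · intro x
    let μ := gaussianReal 0 (2 * c.toNNReal)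
    have key : ∀ i j, ((Real.exp (-c * (a i - a j) ^ 2) : ℝ) : ℂ)
        = ∫ y, Complex.exp (((a j - a i : ℝ) : ℂ) * y * Complex.I) ∂μ := by
      intro i j
      rw [← charFun_apply_real, charFun_gaussianReal]
      push_cast
      rw [Real.coe_toNNReal c hc]
      congr 1
      push_cast
      ring
    have hint : ∀ t : ℝ, Integrable (fun y : ℝ => Complex.exp ((t : ℂ) * y * Complex.I)) μ := by
      intro t
      refine Integrable.of_bound (C := 1) (by fun_prop) (Filter.Eventually.of_forall fun y => ?_)
      rw [← Complex.ofReal_mul, Complex.norm_exp_ofReal_mul_I]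
    have h : star x ⬝ᵥ (Matrix.of fun i j : ι =>
          ((Real.exp (-c * (a i - a j) ^ 2) : ℝ) : ℂ)).mulVec x
        = ∫ y, ((Complex.normSq (∑ j, x j * Complex.exp ((a j : ℂ) * y * Complex.I)) : ℝ) : ℂ) ∂μ := by
      have e : ∀ y : ℝ, ((Complex.normSq (∑ j, x j * Complex.exp ((a j : ℂ) * y * Complex.I)) : ℝ) : ℂ)
          = ∑ i, ∑ j, (star (x i) * x j) * Complex.exp (((a j - a i : ℝ) : ℂ) * y * Complex.I) := by
        intro y
        rw [Complex.normSq_eq_conj_mul_self, map_sum, Finset.sum_mul_sum]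
        refine Finset.sum_congr rfl fun i _ => Finset.sum_congr rfl fun j _ => ?_
        have : (((a j - a i : ℝ) : ℂ) * y * Complex.I)
            = (starRingEnd ℂ) ((a i : ℂ) * y * Complex.I) + (a j : ℂ) * y * Complex.I := by
          simp
          ring
        rw [this, Complex.exp_add, Complex.exp_conj, map_mul]
        simp only [RCLike.star_def]
        ring
      simp_rw [e]
      rw [integral_finsetSum _ fun i _ => integrable_finsetSum _ fun j _ => (hint _).const_mul _]
      simp only [dotProduct, Matrix.mulVec, Pi.star_apply, Matrix.of_apply, Finset.mul_sum]
      refine Finset.sum_congr rfl fun i _ => ?_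
      rw [integral_finsetSum _ fun j _ => (hint _).const_mul _]
      refine Finset.sum_congr rfl fun j _ => ?_
      rw [integral_const_mul, key]
      ring
    rw [h, integral_complex_ofReal]
    exact_mod_cast integral_nonneg fun y => Complex.normSq_nonneg _

lemma prod_psd_s7 {ι κ : Type*} [Fintype ι] (s : Finset κ) (K : κ → Matrix ι ι ℂ)
    (hK : ∀ k, (K k).PosSemidef) :
    Matrix.PosSemidef (Matrix.of fun i j : ι => ∏ k ∈ s, K k i j) := by
  classical
  induction s using Finset.induction_on with
  | empty =>
    have := Matrix.posSemidef_vecMulVec_self_star (fun _ : ι => (1 : ℂ))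
    convert this using 1
    ext i j
    simp [Matrix.vecMulVec]
  | insert k s hk ih =>
    have e : (Matrix.of fun i j : ι => ∏ k ∈ insert k s, K k i j)
        = (K k).hadamard (Matrix.of fun i j => ∏ k ∈ s, K k i j) := by
      ext i j
      simp [Finset.prod_insert hk, Matrix.hadamard]
    rw [e]
    exact (hK k).hadamard ih

/-- The fermionic coincidence rate
`S = ∑ γ σ, sgn(γ) sgn(σ) · conj(A_γ) · (∏ i, exp (-c (τ_{γ⁻¹ i} - τ_{σ⁻¹ i})²)) · A_σ`
is a nonnegative real number. -/
theorem fermionic_rate_nonneg_real (n : ℕ) (A : Matrix (Fin n) (Fin n) ℂ)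
    (c : ℝ) (hc : 0 ≤ c) (τ : Fin n → ℝ)
    (v : Equiv.Perm (Fin n) → ℂ) (hv : ∀ γ : Equiv.Perm (Fin n), v γ = ∏ i, A (γ i) i)
    (S : ℂ)
    (hS : S = ∑ γ : Equiv.Perm (Fin n), ∑ σ : Equiv.Perm (Fin n),
      (((Equiv.Perm.sign γ : ℤ) * (Equiv.Perm.sign σ : ℤ) : ℤ) : ℂ) *
        (starRingEnd ℂ) (v γ) *
        ((∏ i, Real.exp (-c * (τ (γ⁻¹ i) - τ (σ⁻¹ i)) ^ 2) : ℝ) : ℂ) * v σ) :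
    S.im = 0 ∧ 0 ≤ S.re := by

  have hp := prod_psd_s7 (Finset.univ : Finset (Fin n))
    (fun k => Matrix.of fun γ σ : Equiv.Perm (Fin n) =>
      ((Real.exp (-c * (τ (γ⁻¹ k) - τ (σ⁻¹ k)) ^ 2) : ℝ) : ℂ))
    (fun k => gauss_kernel_psd c hc fun γ : Equiv.Perm (Fin n) => τ (γ⁻¹ k))
  have h := hp.dotProduct_mulVec_nonneg (fun γ => ((Equiv.Perm.sign γ : ℤ) : ℂ) * v γ)
  have e : S = star (fun γ => ((Equiv.Perm.sign γ : ℤ) : ℂ) * v γ) ⬝ᵥ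
      (Matrix.of fun γ σ : Equiv.Perm (Fin n) => ∏ k ∈ (Finset.univ : Finset (Fin n)),
        (Matrix.of fun γ σ : Equiv.Perm (Fin n) =>
      ((Real.exp (-c * (τ (γ⁻¹ k) - τ (σ⁻¹ k)) ^ 2) : ℝ) : ℂ)) γ σ).mulVec
        (fun γ => ((Equiv.Perm.sign γ : ℤ) : ℂ) * v γ) := by
    rw [hS]
    simp only [dotProduct, Matrix.mulVec, Pi.star_apply, Matrix.of_apply, Finset.mul_sum]
    refine Finset.sum_congr rfl fun γ _ => Finset.sum_congr rfl fun σ _ => ?_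
    rw [Complex.ofReal_prod, RCLike.star_def, map_mul, map_intCast]
    push_cast
    ring
  rw [← e, Complex.le_def] at h
  exact ⟨h.2.symm, h.1⟩
end

section
/- Let n be a natural number and A : Matrix (Fin n) (Fin n) ℂ, with monomials v γ = ∏ i, A (γ i) i for γ : Equiv.Perm (Fin n). If the delay matrix is the identity matrix (all particles fully distinguishable), so that the rate-matrix entry for (γ, σ) is ∏ i, (1 : Matrix (Fin n) (Fin n) ℝ) (γ⁻¹ i) (σ⁻¹ i), then both the bosonic coincidence rate ∑ γ, ∑ σ, (starRingEnd ℂ) (v γ) * ((∏ i, (1 : Matrix (Fin n) (Fin n) ℝ) (γ⁻¹ i) (σ⁻¹ i) : ℝ) : ℂ) * (v σ) and the corresponding fermionic rate (with the extra factor sgn(γ)·sgn(σ)) are equal to (∑ γ, ∏ i, (Complex.normSq (A (γ i) i) : ℂ)), i.e., to the permanent of the entrywise squared-modulus matrix of A. -/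
/-- In the fully distinguishable ('classical') limit, where the delay matrix is the
identity, both the bosonic and fermionic coincidence rates collapse to the
permanent of the entrywise squared-modulus matrix of `A`. -/
theorem distinguishable_rates_permanent_of_normSq (n : ℕ)
    (A : Matrix (Fin n) (Fin n) ℂ)
    (v : Equiv.Perm (Fin n) → ℂ) (hv : ∀ γ : Equiv.Perm (Fin n), v γ = ∏ i, A (γ i) i) :
    (∑ γ : Equiv.Perm (Fin n), ∑ σ : Equiv.Perm (Fin n),
        (starRingEnd ℂ) (v γ) *
          ((∏ i, (1 : Matrix (Fin n) (Fin n) ℝ) (γ⁻¹ i) (σ⁻¹ i) : ℝ) : ℂ) * v σ)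
      = (∑ γ : Equiv.Perm (Fin n), ∏ i, (Complex.normSq (A (γ i) i) : ℂ)) ∧
    (∑ γ : Equiv.Perm (Fin n), ∑ σ : Equiv.Perm (Fin n),
        (((Equiv.Perm.sign γ : ℤ) * (Equiv.Perm.sign σ : ℤ) : ℤ) : ℂ) *
          (starRingEnd ℂ) (v γ) *
          ((∏ i, (1 : Matrix (Fin n) (Fin n) ℝ) (γ⁻¹ i) (σ⁻¹ i) : ℝ) : ℂ) * v σ)
      = (∑ γ : Equiv.Perm (Fin n), ∏ i, (Complex.normSq (A (γ i) i) : ℂ)) := by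
  have key : ∀ γ σ : Equiv.Perm (Fin n),
      ((∏ i, (1 : Matrix (Fin n) (Fin n) ℝ) (γ⁻¹ i) (σ⁻¹ i) : ℝ) : ℂ)
        = if γ = σ then 1 else 0 := by
    intro γ σ
    by_cases h : γ = σ
    · subst h
      simp
    · rw [if_neg h]
      have h2 : ∃ i, γ⁻¹ i ≠ σ⁻¹ i := by
        by_contra hc
        push Not at hc
        exact h (inv_injective (Equiv.ext hc))
      obtain ⟨i, hi⟩ := h2
      have h3 : (∏ i, (1 : Matrix (Fin n) (Fin n) ℝ) (γ⁻¹ i) (σ⁻¹ i) : ℝ) = 0 :=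
        Finset.prod_eq_zero (i := i) (Finset.mem_univ i) (Matrix.one_apply_ne hi)
      exact_mod_cast h3
  have hd : ∀ γ : Equiv.Perm (Fin n),
      (starRingEnd ℂ) (v γ) * v γ = ∏ i, (Complex.normSq (A (γ i) i) : ℂ) := by
    intro γ
    rw [hv, map_prod, ← Finset.prod_mul_distrib]
    exact Finset.prod_congr rfl fun i _ => (Complex.normSq_eq_conj_mul_self).symm
  have hs : ∀ γ : Equiv.Perm (Fin n),
      (((Equiv.Perm.sign γ : ℤ) * (Equiv.Perm.sign γ : ℤ) : ℤ) : ℂ) = 1 := by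
    intro γ
    rw [← Units.val_mul, Int.units_mul_self]
    simp
  constructor
  · refine Finset.sum_congr rfl fun γ _ => ?_
    rw [← hd γ, Finset.sum_eq_single γ]
    · rw [key, if_pos rfl, mul_one]
    · intro σ _ h
      rw [key, if_neg h.symm, mul_zero, zero_mul]
    · simp
  · refine Finset.sum_congr rfl fun γ _ => ?_
    rw [← hd γ, Finset.sum_eq_single γ]
    · rw [key, if_pos rfl, hs, mul_one, one_mul]
    · intro σ _ h
      rw [key, if_neg h.symm, mul_zero, zero_mul]
    · simp
end

section
/- Let n, b : ℕ and let m : ℕ → ℕ satisfy ∑ i ∈ Finset.Icc 1 n, i * m i = n and k := ∑ i ∈ Finset.Icc 1 n, m i ≤ b. Let N be the number of functions f : Fin n → Fin b such that for every i with 1 ≤ i ≤ n, the number of bins j : Fin b whose fiber has exactly i elements, i.e. (Finset.univ.filter (fun j => (Finset.univ.filter (fun x => f x = j)).card = i)).card, equals m i. Then N * ((b - k).factorial * (∏ i ∈ Finset.Icc 1 n, (i.factorial) ^ (m i)) * (∏ i ∈ Finset.Icc 1 n, (m i).factorial)) = n.factorial * b.factorial. -/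
open Classical in
theorem count_fibers {α ι : Type} [Fintype α] [Fintype ι] (c : ι → ℕ)
    (hc : ∑ j, c j = Fintype.card α) :
    (Finset.univ.filter (fun f : α → ι =>
      ∀ j, (Finset.univ.filter (fun x => f x = j)).card = c j)).card * ∏ j, (c j).factorial
      = (Fintype.card α).factorial := by
  obtain ⟨e⟩ : Nonempty (α ≃ (Σ j, Fin (c j))) := by
    apply Fintype.card_eq.mp
    simp [hc]
  let g : α → ι := fun x => (e x).1
  have hg : ∀ j, Fintype.card {x // g x = j} = c j := by
    intro j
    have e1 : {x // g x = j} ≃ {y : (Σ j, Fin (c j)) // y.1 = j} :=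
      e.subtypeEquiv (fun a => Iff.rfl)
    have e2 : {y : (Σ j, Fin (c j)) // y.1 = j} ≃ Fin (c j) := Equiv.sigmaSubtype j
    simpa using Fintype.card_congr (e1.trans e2)
  let _ : Fintype (Equiv.Perm α)ᵈᵐᵃ := Fintype.ofEquiv (Equiv.Perm α) DomMulAct.mk
  have key := MulAction.card_orbit_mul_card_stabilizer_eq_card_group (Equiv.Perm α)ᵈᵐᵃ g
  have hst := DomMulAct.stabilizer_card g
  have horb : Fintype.card (MulAction.orbit (Equiv.Perm α)ᵈᵐᵃ g) =
      (Finset.univ.filter (fun f : α → ι =>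
      ∀ j, (Finset.univ.filter (fun x => f x = j)).card = c j)).card := by
    rw [← Set.toFinset_card]
    congr 1
    ext f
    simp only [Set.mem_toFinset, Finset.mem_filter, Finset.mem_univ, true_and]
    constructor
    · rintro ⟨σ, rfl⟩ j
      rw [← hg j, ← Fintype.card_subtype]
      exact Fintype.card_congr ((DomMulAct.mk.symm σ).subtypeEquiv (fun a => Iff.rfl))
    · intro h
      have hh : ∀ j, Nonempty ({x // f x = j} ≃ {x // g x = j}) := by
        intro j
        apply Fintype.card_eq.mp
        rw [hg j, ← h j, Fintype.card_subtype]
      let E := fun j => (hh j).some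
      refine ⟨DomMulAct.mk (Equiv.ofFiberEquiv E), ?_⟩
      funext x
      exact Equiv.ofFiberEquiv_map E x
  have hG : Fintype.card (Equiv.Perm α)ᵈᵐᵃ = (Fintype.card α).factorial := by
    rw [← Fintype.card_perm]; exact Fintype.card_congr DomMulAct.mk.symm
  rw [hG, horb] at key
  rw [← key]
  congr 1
  simp only [hg] at hst
  rw [← hst]
  exact Fintype.card_congr (DomMulAct.mk.subtypeEquiv (fun _ => Iff.rfl))

theorem prod_fin_Icc {M : Type} [CommMonoid M] (n : ℕ) (g : ℕ → M) :
    ∏ i : Fin (n+1), g i = g 0 * ∏ i ∈ Finset.Icc 1 n, g i := by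
  rw [Fin.prod_univ_eq_prod_range (fun i => g i), Finset.prod_range_succ', mul_comm,
    Finset.range_eq_Ico, Finset.prod_Ico_add' (fun i => g i) 0 n 1]
  rfl

theorem sum_fin_Icc (n : ℕ) (g : ℕ → ℕ) :
    ∑ i : Fin (n+1), g i = g 0 + ∑ i ∈ Finset.Icc 1 n, g i := by
  rw [Fin.sum_univ_eq_sum_range (fun i => g i), Finset.sum_range_succ', add_comm,
    Finset.range_eq_Ico, Finset.sum_Ico_add' (fun i => g i) 0 n 1]
  rfl


open Classical in
/-- Counting form of the delay-partition probability formula: the number `N` of ways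
`n` particles can land in `b` time bins so that exactly `m i` bins contain exactly
`i` particles (for each `1 ≤ i ≤ n`) satisfies
`N · (b - k)! · ∏ (i!)^(m i) · ∏ (m i)! = n! · b!`, where `k = ∑ m i` is the number
of occupied bins. -/
theorem delay_partition_count (n b : ℕ) (m : ℕ → ℕ)
    (hsum : ∑ i ∈ Finset.Icc 1 n, i * m i = n)
    (hk : ∑ i ∈ Finset.Icc 1 n, m i ≤ b)
    (N : ℕ)
    (hN : N = (Finset.univ.filter (fun f : Fin n → Fin b =>
        ∀ i ∈ Finset.Icc 1 n,
          (Finset.univ.filter (fun j : Fin b =>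
            (Finset.univ.filter (fun x : Fin n => f x = j)).card = i)).card = m i)).card) :
    N * ((b - ∑ i ∈ Finset.Icc 1 n, m i).factorial *
        (∏ i ∈ Finset.Icc 1 n, (Nat.factorial i) ^ (m i)) *
        (∏ i ∈ Finset.Icc 1 n, (m i).factorial))
      = n.factorial * b.factorial := by
  set k := ∑ i ∈ Finset.Icc 1 n, m i with hkdef
  let m' : ℕ → ℕ := fun i => if i = 0 then b - k else m i
  have hm0 : m' 0 = b - k := by simp [m']
  have hmi : ∀ i ∈ Finset.Icc 1 n, m' i = m i := by
    intro i hi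
    have : i ≠ 0 := by have := (Finset.mem_Icc.mp hi).1; omega
    simp [m', this]
  have hm'sum : ∑ i : Fin (n+1), m' i = b := by
    rw [sum_fin_Icc, hm0, Finset.sum_congr rfl hmi]
    change b - k + k = b
    omega
  have L2 := count_fibers (α := Fin b) (ι := Fin (n+1)) (fun i => m' i) (by simpa using hm'sum)
  set C := (Finset.univ.filter (fun f : Fin b → Fin (n+1) =>
      ∀ j, (Finset.univ.filter (fun x => f x = j)).card = m' j)) with hC
  rw [prod_fin_Icc n (fun i => (m' i).factorial), hm0,
    Finset.prod_congr rfl (fun i hi => by rw [hmi i hi] :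
      ∀ i ∈ Finset.Icc 1 n, (m' i).factorial = (m i).factorial), Fintype.card_fin] at L2
  have hlt : ∀ (f : Fin n → Fin b) (j : Fin b),
      (Finset.univ.filter (fun x : Fin n => f x = j)).card < n + 1 := by
    intro f j
    have := Finset.card_le_univ (Finset.univ.filter (fun x : Fin n => f x = j))
    rw [Fintype.card_fin] at this
    omega
  let F : (Fin n → Fin b) → (Fin b → Fin (n+1)) := fun f j => ⟨_, hlt f j⟩
  have hP : ∀ f : Fin n → Fin b, (∀ i ∈ Finset.Icc 1 n,
          (Finset.univ.filter (fun j : Fin b =>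
            (Finset.univ.filter (fun x : Fin n => f x = j)).card = i)).card = m i) ↔ F f ∈ C := by
    intro f
    have hcnt : ∀ i : Fin (n+1), (Finset.univ.filter (fun j => F f j = i)).card =
        (Finset.univ.filter (fun j : Fin b =>
            (Finset.univ.filter (fun x : Fin n => f x = j)).card = (i:ℕ))).card := by
      intro i
      congr 1
      ext j
      simp [F, Fin.ext_iff]
    rw [hC, Finset.mem_filter]
    simp only [Finset.mem_univ, true_and, hcnt]
    constructor
    · intro h i
      by_cases hi : (i : ℕ) = 0
      · have ht : ∑ i : Fin (n+1), (Finset.univ.filter (fun j => F f j = i)).card = b := by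
          rw [← Finset.card_eq_sum_card_fiberwise (fun _ _ => Finset.mem_coe.mpr (Finset.mem_univ _))]
          simp
        simp only [hcnt] at ht
        rw [sum_fin_Icc n (fun i => (Finset.univ.filter (fun j : Fin b =>
            (Finset.univ.filter (fun x : Fin n => f x = j)).card = i)).card),
          Finset.sum_congr rfl h] at ht
        change _ + k = b at ht
        rw [hi, hm0]
        omega
      · have hI : (i : ℕ) ∈ Finset.Icc 1 n := by
          rw [Finset.mem_Icc]; omega
        rw [hmi _ hI]; exact h _ hI
    · intro h i hi
      rw [← hmi i hi]
      exact h ⟨i, by have := (Finset.mem_Icc.mp hi).2; omega⟩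
  have hfib : ∀ c ∈ C, (Finset.univ.filter (fun f : Fin n → Fin b => F f = c)).card *
      (∏ i ∈ Finset.Icc 1 n, (Nat.factorial i) ^ (m i)) = n.factorial := by
    intro c hc
    have hc' := (Finset.mem_filter.mp hc).2
    have h1 : ∑ j, (c j : ℕ) = n := by
      rw [← Finset.sum_fiberwise_of_maps_to' (s := Finset.univ) (t := Finset.univ) (g := c)
        (fun _ _ => Finset.mem_univ _) (fun i => (i : ℕ))]
      simp only [Finset.sum_const, hc', smul_eq_mul]
      rw [sum_fin_Icc n (fun i => m' i * i), mul_zero, zero_add]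
      conv_rhs => rw [← hsum]
      exact Finset.sum_congr rfl (fun i hi => by rw [hmi i hi, mul_comm])
    have h2 : ∏ j, (c j : ℕ).factorial = ∏ i ∈ Finset.Icc 1 n, (Nat.factorial i) ^ (m i) := by
      rw [← Finset.prod_fiberwise_of_maps_to' (s := Finset.univ) (t := Finset.univ) (g := c)
        (fun _ _ => Finset.mem_univ _) (fun i => (i : ℕ).factorial)]
      simp only [Finset.prod_const, hc']
      rw [prod_fin_Icc n (fun i => (i.factorial) ^ m' i), Nat.factorial_zero, one_pow, one_mul]
      exact Finset.prod_congr rfl (fun i hi => by rw [hmi i hi])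
    have L1 := count_fibers (α := Fin n) (ι := Fin b) (fun j => (c j : ℕ)) (by simpa using h1)
    rw [h2, Fintype.card_fin] at L1
    rw [← L1]
    congr 2
    ext f
    simp [F, funext_iff, Fin.ext_iff]
  have hN2 : N = ∑ c ∈ C, (Finset.univ.filter (fun f : Fin n → Fin b => F f = c)).card := by
    rw [hN]
    simp only [hP]
    rw [Finset.card_eq_sum_card_fiberwise (f := F) (t := C)
      (fun f hf => by simpa using hf)]
    refine Finset.sum_congr rfl (fun c hc => ?_)
    congr 1
    ext f
    simp only [Finset.mem_filter, Finset.mem_univ, true_and]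
    constructor
    · exact fun h => h.2
    · exact fun h => ⟨h ▸ hc, h⟩
  have hN3 : N * (∏ i ∈ Finset.Icc 1 n, (Nat.factorial i) ^ (m i)) = C.card * n.factorial := by
    rw [hN2, Finset.sum_mul, Finset.sum_congr rfl hfib, Finset.sum_const, smul_eq_mul]
  calc _ = (N * (∏ i ∈ Finset.Icc 1 n, (Nat.factorial i) ^ (m i))) *
        ((b - k).factorial * (∏ i ∈ Finset.Icc 1 n, (m i).factorial)) := by ring
    _ = n.factorial * (C.card * ((b - k).factorial *
          (∏ i ∈ Finset.Icc 1 n, (m i).factorial))) := by rw [hN3]; ring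
    _ = _ := by
      rw [← L2]
      congr!
end

section
/- Let n, b, t : ℕ with 2 * t > n. Then the number of functions f : Fin n → Fin b that have some bin with exactly t particles, i.e. the cardinality of {f : Fin n → Fin b | ∃ j : Fin b, (Finset.univ.filter (fun x => f x = j)).card = t}, equals b * Nat.choose n t * (b - 1) ^ (n - t). -/
theorem aux_fiber (n b : ℕ) (j : Fin b) (S : Finset (Fin n)) :
    (Finset.univ.filter (fun f : Fin n → Fin b =>
      Finset.univ.filter (fun x : Fin n => f x = j) = S)).card = (b - 1) ^ (n - S.card) := by
  have h : (Finset.univ.filter (fun f : Fin n → Fin b =>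
      Finset.univ.filter (fun x : Fin n => f x = j) = S))
      = Fintype.piFinset (fun x => if x ∈ S then {j} else Finset.univ.erase j) := by
    ext f
    simp only [Finset.mem_filter, Finset.mem_univ, true_and, Fintype.mem_piFinset, Finset.ext_iff]
    refine forall_congr' fun x => ?_
    by_cases hx : x ∈ S <;> simp [hx]
  rw [h, Fintype.card_piFinset]
  have h2 : ∀ x : Fin n, (if x ∈ S then ({j} : Finset (Fin b)) else Finset.univ.erase j).card
      = if x ∈ S then 1 else b - 1 := by
    intro x
    split_ifs <;> simp
  rw [Finset.prod_congr rfl (fun x _ => h2 x), Finset.prod_ite]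
  simp only [Finset.prod_const, one_pow, one_mul]
  congr 1
  have h3 : Finset.univ.filter (fun x => x ∉ S) = Sᶜ := by ext; simp
  rw [h3, Finset.card_compl, Fintype.card_fin]

theorem aux_bin (n b t : ℕ) (j : Fin b) :
    (Finset.univ.filter (fun f : Fin n → Fin b =>
      (Finset.univ.filter (fun x : Fin n => f x = j)).card = t)).card
      = Nat.choose n t * (b - 1) ^ (n - t) := by
  rw [Finset.card_eq_sum_card_fiberwise
    (f := fun f : Fin n → Fin b => Finset.univ.filter (fun x : Fin n => f x = j))
    (t := Finset.powersetCard t Finset.univ)]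
  · rw [Finset.sum_congr rfl (g := fun _ => (b - 1) ^ (n - t))]
    · simp
    · intro S hS
      rw [Finset.mem_powersetCard] at hS
      rw [← hS.2, ← aux_fiber n b j S, Finset.filter_filter]
      congr 1
      ext f
      simp only [Finset.mem_filter, Finset.mem_univ, true_and]
      exact ⟨fun h => h.2, fun h => ⟨by rw [h], h⟩⟩
  · intro f hf
    simpa [Finset.mem_powersetCard] using hf

/-- If `2t > n`, the number of ways for `n` particles to land in `b` time bins such
that some bin contains exactly `t` particles is `b · C(n,t) · (b-1)^(n-t)`. -/
theorem count_bin_with_exactly_t (n b t : ℕ) (ht : 2 * t > n) :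
    Nat.card {f : Fin n → Fin b | ∃ j : Fin b,
        (Finset.univ.filter (fun x : Fin n => f x = j)).card = t}
      = b * Nat.choose n t * (b - 1) ^ (n - t) := by
  have h : {f : Fin n → Fin b | ∃ j : Fin b,
        (Finset.univ.filter (fun x : Fin n => f x = j)).card = t}
      = ((Finset.univ.biUnion fun j : Fin b => Finset.univ.filter (fun f : Fin n → Fin b =>
      (Finset.univ.filter (fun x : Fin n => f x = j)).card = t) : Finset (Fin n → Fin b)) :
        Set (Fin n → Fin b)) := by
    ext f
    simp
  rw [h, Nat.card_coe_set_eq, Set.ncard_coe_finset, Finset.card_biUnion]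
  · simp [aux_bin, mul_assoc]
  · intro i _ j _ hij
    rw [Function.onFun, Finset.disjoint_left]
    intro f hi hj
    simp only [Finset.mem_filter, Finset.mem_univ, true_and] at hi hj
    have hd : Disjoint (Finset.univ.filter (fun x : Fin n => f x = i))
        (Finset.univ.filter (fun x : Fin n => f x = j)) := by
      rw [Finset.disjoint_left]
      intro x h1 h2
      simp only [Finset.mem_filter, Finset.mem_univ, true_and] at h1 h2
      exact hij (h1.symm.trans h2)
    have hc := Finset.card_union_of_disjoint hd
    have hle := Finset.card_le_univ (Finset.univ.filter (fun x : Fin n => f x = i) ∪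
      Finset.univ.filter (fun x : Fin n => f x = j))
    rw [hc, hi, hj, Fintype.card_fin] at hle
    omega
end

section
/- For every natural number b with 5 ≤ b there exists a constant C > 0 such that for every n : ℕ, the number of functions f : Fin n → Fin b having some bin with more than ⌈n/2⌉ particles satisfies (Nat.card {f : Fin n → Fin b | ∃ j : Fin b, (Finset.univ.filter (fun x => f x = j)).card > (n + 1) / 2} : ℝ) ≤ C * (4 / 5) ^ n * (b : ℝ) ^ n. In particular, the probability that a uniformly random f : Fin n → Fin b has at most ⌈n/2⌉ particles in every bin differs from 1 by a quantity that decays exponentially in n. -/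
/-- For `b ≥ 5` time bins, the number of ways for `n` particles to land in the bins
with some bin containing more than `⌈n/2⌉` particles is at most `C · (4/5)^n · bⁿ`
for a positive constant `C` independent of `n`; hence the probability that every bin
contains at most `⌈n/2⌉` particles differs from `1` by a quantity decaying
exponentially in `n`. -/
theorem majority_bin_probability_exponentially_small (b : ℕ) (hb : 5 ≤ b) :
    ∃ C : ℝ, 0 < C ∧ ∀ n : ℕ,
      (Nat.card {f : Fin n → Fin b | ∃ j : Fin b,
          (Finset.univ.filter (fun x : Fin n => f x = j)).card > (n + 1) / 2} : ℝ)
        ≤ C * (4 / 5) ^ n * (b : ℝ) ^ n := by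
  classical
  refine ⟨b, by exact_mod_cast (by omega : 0 < b), fun n => ?_⟩
  have key : Nat.card {f : Fin n → Fin b | ∃ j : Fin b,
          (Finset.univ.filter (fun x : Fin n => f x = j)).card > (n + 1) / 2} * 2 ^ n
        ≤ b * (b + 3) ^ n := by
    have hsum : ∀ j : Fin b, ∑ f : Fin n → Fin b, ∏ x, (if f x = j then 4 else 1 : ℕ)
        = (b + 3) ^ n := by
      intro j
      have h1 : ∑ i : Fin b, (if i = j then 4 else 1 : ℕ) = b + 3 := by
        have : ∀ i : Fin b, (if i = j then 4 else 1 : ℕ) = 1 + (if i = j then 3 else 0) := by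
          intro i; split_ifs <;> rfl
        simp only [this, Finset.sum_add_distrib]
        simp
      have h2 := Finset.prod_univ_sum (fun _ : Fin n => (Finset.univ : Finset (Fin b)))
        (fun _ i => (if i = j then 4 else 1 : ℕ))
      rw [Fintype.piFinset_univ] at h2
      rw [← h2]
      simp only [h1]
      simp
    rw [Set.coe_setOf, Nat.card_eq_fintype_card, Fintype.card_subtype, ← smul_eq_mul, ← Finset.sum_const]
    calc _ ≤ ∑ f ∈ Finset.univ.filter (fun f : Fin n → Fin b => ∃ j : Fin b,
          (Finset.univ.filter (fun x : Fin n => f x = j)).card > (n + 1) / 2),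
            ∑ j : Fin b, ∏ x, (if f x = j then 4 else 1 : ℕ) := by
          refine Finset.sum_le_sum fun f hf => ?_
          obtain ⟨j, hj⟩ := (Finset.mem_filter.1 hf).2
          refine le_trans ?_ (Finset.single_le_sum (fun _ _ => Nat.zero_le _) (Finset.mem_univ j))
          rw [Finset.prod_ite, Finset.prod_const, Finset.prod_const_one, mul_one,
            show (4 : ℕ) = 2 ^ 2 from rfl, ← pow_mul]
          exact Nat.pow_le_pow_right (by norm_num) (by omega)
      _ ≤ ∑ f : Fin n → Fin b, ∑ j : Fin b, ∏ x, (if f x = j then 4 else 1 : ℕ) :=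
          Finset.sum_le_sum_of_subset (Finset.filter_subset _ _)
      _ = b * (b + 3) ^ n := by
          rw [Finset.sum_comm]
          simp only [hsum]
          simp
  have key' : (Nat.card {f : Fin n → Fin b | ∃ j : Fin b,
          (Finset.univ.filter (fun x : Fin n => f x = j)).card > (n + 1) / 2} : ℝ) * 2 ^ n
        ≤ b * ((b : ℝ) + 3) ^ n := by exact_mod_cast key
  have hb' : (5 : ℝ) ≤ b := by exact_mod_cast hb
  have h3 : ((b : ℝ) + 3) ^ n ≤ (4 / 5 * b * 2) ^ n := by
    apply pow_le_pow_left₀ <;> linarith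
  rw [mul_pow, mul_pow] at h3
  refine le_of_mul_le_mul_right (a := (2 : ℝ) ^ n) ?_ (by positivity)
  refine key'.trans ((mul_le_mul_of_nonneg_left h3 (by positivity)).trans (le_of_eq ?_))
  ring
end
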